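/- Define φ(r,c) = C(k,r)·C(k,c)·C(n,k−r)·C(n,k−c)·a^(r·c). For every fixed integer a ≥ 2 there exists K such that for all integers k ≥ K and all integers n with k·a^(k/2)/e ≤ (n : ℝ) ≤ (k·a^(k/2)/e)·(1 + 2·log k/k), one has φ(k−1,k) ≥ φ(1,1). Here a^(k/2) denotes the real power, log the natural logarithm, and e Euler's number. -/

import Mathlib

/-- `φ(r,c) = C(k,r)·C(k,c)·C(n,k−r)·C(n,k−c)·a^(r·c)`. -/
def phi (n k a r c : ℕ) : ℕ :=
  k.choose r * k.choose c * n.choose (k - r) * n.choose (k - c) * a ^ (r * c)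

lemma phi_aux_growth (a : ℕ) (ha : 2 ≤ a) : ∃ K : ℕ, ∀ k : ℕ, K ≤ k →
    (k : ℝ) ^ 4 * Real.exp 1 ^ 3 * a ≤ (a : ℝ) ^ ((k : ℝ) / 2) := by
  have ha1 : (1 : ℝ) < a := by exact_mod_cast (by omega : 1 < a)
  have hb : 0 < Real.log a / 2 := by have := Real.log_pos ha1; linarith
  have h := isLittleO_pow_exp_pos_mul_atTop 4 hb
  have hc : 0 < Real.exp 1 ^ 3 * (a : ℝ) := by positivity
  have h2 := (h.def (inv_pos.mpr hc)).natCast_atTop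
  obtain ⟨K, hK⟩ := Filter.eventually_atTop.mp h2
  refine ⟨K, fun k hk => ?_⟩
  have h3 := hK k hk
  rw [Real.norm_of_nonneg (by positivity), Real.norm_of_nonneg (by positivity),
    inv_mul_eq_div, le_div_iff₀ hc] at h3
  rw [Real.rpow_def_of_pos (by positivity), mul_assoc]
  rw [show Real.log (a : ℝ) * ((k : ℝ) / 2) = Real.log a / 2 * k by ring]
  exact h3

lemma phi_aux_fact (k : ℕ) : ((k : ℝ) / Real.exp 1) ^ k ≤ (k.factorial : ℝ) := by
  have h := Real.pow_div_factorial_le_exp (k : ℝ) (by positivity) k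
  rw [div_le_iff₀ (by positivity)] at h
  rw [div_pow, div_le_iff₀ (by positivity), ← Real.exp_nat_mul, mul_one]
  linarith

lemma phi_aux_real (m : ℕ) (a x A e k : ℝ) (F G C : ℝ) (hk : k = m + 2) (ha : 0 < a)
    (hx : 0 ≤ x) (hA : 0 < A) (he : 0 < e) (hF : 0 < F) (hC0 : 0 ≤ C) (hG : G = k * F)
    (hGk : (k / e) ^ (m + 2) ≤ G) (hC : C ≤ x ^ (m + 1) / F)
    (hxp : x ^ (2 * m + 1) ≤ (k * A / e) ^ (2 * m + 1) * k ^ 4)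
    (hgr : k ^ 4 * e ^ 3 * a ≤ A) :
    k * k * C * C * a ≤ k * x * (A ^ 2) ^ (m + 1) := by
  have hk0 : 0 < k := by rw [hk]; positivity
  have h1 : C * C ≤ x ^ (m + 1) / F * (x ^ (m + 1) / F) :=
    mul_le_mul hC hC hC0 (by positivity)
  have h2 : (k / e) ^ (m + 2) * (k / e) ^ (m + 2) ≤ G * G :=
    mul_le_mul hGk hGk (by positivity) (by rw [hG]; positivity)
  have h3 : x ^ (2 * m + 1) * k ^ 3 * a ≤ G * G * (A ^ 2) ^ (m + 1) := by
    calc x ^ (2 * m + 1) * k ^ 3 * a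
        ≤ (k * A / e) ^ (2 * m + 1) * k ^ 4 * k ^ 3 * a := by gcongr
      _ = ((k / e) ^ (2 * m + 1) * A ^ (2 * m + 1) * (k / e) ^ 3) * (k ^ 4 * e ^ 3 * a) := by
          rw [mul_div_right_comm, mul_pow (k / e) A]
          field_simp
      _ ≤ ((k / e) ^ (2 * m + 1) * A ^ (2 * m + 1) * (k / e) ^ 3) * A := by gcongr
      _ = (k / e) ^ (m + 2) * (k / e) ^ (m + 2) * (A ^ 2) ^ (m + 1) := by ring
      _ ≤ _ := by gcongr
  have h4 : x ^ (2 * m + 1) * k * a ≤ F * F * (A ^ 2) ^ (m + 1) := by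
    rw [hG] at h3
    have : k ^ 2 * (x ^ (2 * m + 1) * k * a) ≤ k ^ 2 * (F * F * (A ^ 2) ^ (m + 1)) := by
      linarith
    exact le_of_mul_le_mul_left this (by positivity)
  calc k * k * C * C * a = k * k * a * (C * C) := by ring
    _ ≤ k * k * a * (x ^ (m + 1) / F * (x ^ (m + 1) / F)) := by gcongr
    _ = k * x * (x ^ (2 * m + 1) * k * a) / (F * F) := by field_simp; ring
    _ ≤ k * x * (F * F * (A ^ 2) ^ (m + 1)) / (F * F) := by gcongr
    _ = _ := by field_simp

theorem phi_corner_ge_phi_one_one (a : ℕ) (ha : 2 ≤ a) :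
    ∃ K : ℕ, ∀ k : ℕ, K ≤ k → ∀ n : ℕ,
      (k : ℝ) * (a : ℝ) ^ ((k : ℝ) / 2) / Real.exp 1 ≤ (n : ℝ) →
      (n : ℝ) ≤ (k : ℝ) * (a : ℝ) ^ ((k : ℝ) / 2) / Real.exp 1 *
        (1 + 2 * Real.log k / k) →
      phi n k a (k - 1) k ≥ phi n k a 1 1 := by
  obtain ⟨K, hK⟩ := phi_aux_growth a ha
  refine ⟨K + 2, fun k hk n _ hn => ?_⟩
  have hgr := hK k (by omega)
  obtain ⟨m, rfl⟩ : ∃ m, k = m + 2 := ⟨k - 2, by omega⟩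
  have ha0 : (0 : ℝ) < a := by exact_mod_cast (by omega : 0 < a)
  have hA : 0 < (a : ℝ) ^ (((m + 2 : ℕ) : ℝ) / 2) := by positivity
  have hA2 : ((a : ℝ) ^ (((m + 2 : ℕ) : ℝ) / 2)) ^ 2 = (a : ℝ) ^ (m + 2) := by
    rw [← Real.rpow_natCast, ← Real.rpow_mul ha0.le, ← Real.rpow_natCast]
    congr 1
    push_cast
    ring
  have hk0 : (0 : ℝ) < ((m + 2 : ℕ) : ℝ) := by positivity
  have hk1 : (1 : ℝ) ≤ ((m + 2 : ℕ) : ℝ) := by exact_mod_cast (by omega)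
  have hlog := Real.log_nonneg hk1
  have hd : (1 + 2 * Real.log ((m + 2 : ℕ) : ℝ) / ((m + 2 : ℕ) : ℝ)) ^ (2 * m + 1)
      ≤ ((m + 2 : ℕ) : ℝ) ^ 4 := by
    have h1 := Real.add_one_le_exp (2 * Real.log ((m + 2 : ℕ) : ℝ) / ((m + 2 : ℕ) : ℝ))
    have h4 : ((m + 2 : ℕ) : ℝ) ^ 4 = Real.exp (4 * Real.log ((m + 2 : ℕ) : ℝ)) := by
      rw [show (4 : ℝ) = ((4 : ℕ) : ℝ) by norm_num, Real.exp_nat_mul, Real.exp_log hk0]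
    rw [add_comm, h4]
    refine (pow_le_pow_left₀ (by positivity) h1 _).trans ?_
    rw [← Real.exp_nat_mul]
    apply Real.exp_le_exp.mpr
    rw [mul_div_assoc', div_le_iff₀ hk0]
    push_cast at hlog ⊢
    nlinarith
  have hxp : (n : ℝ) ^ (2 * m + 1) ≤ (((m + 2 : ℕ) : ℝ) * (a : ℝ) ^ (((m + 2 : ℕ) : ℝ) / 2)
      / Real.exp 1) ^ (2 * m + 1) * ((m + 2 : ℕ) : ℝ) ^ 4 := by
    refine (pow_le_pow_left₀ (by positivity) hn _).trans ?_
    rw [mul_pow]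
    gcongr
  have key := phi_aux_real m a n _ (Real.exp 1) ((m + 2 : ℕ) : ℝ) ((m + 1).factorial : ℝ)
    ((m + 2).factorial : ℝ) (n.choose (m + 1) : ℝ) (by push_cast; ring) ha0 (by positivity) hA
    (by positivity) (by positivity) (by positivity)
    (by rw [Nat.factorial_succ (m + 1)]; push_cast; ring)
    (phi_aux_fact (m + 2)) (Nat.choose_le_pow_div (m + 1) n) hxp hgr
  rw [hA2, ← pow_mul] at key
  have e1 : phi n (m + 2) a (m + 2 - 1) (m + 2) = (m + 2) * n * a ^ ((m + 2) * (m + 1)) := by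
    have : (m + 2).choose (m + 1) = m + 2 := Nat.choose_succ_self_right (m + 1)
    simp [phi, this, mul_comm (m + 1)]
  have e2 : phi n (m + 2) a 1 1
      = (m + 2) * (m + 2) * n.choose (m + 1) * n.choose (m + 1) * a := by
    simp [phi]
  rw [e1, e2]
  exact_mod_cast key
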